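/- arXiv:2006.08667 — 4 statements merged into one kernel-verified Lean document; each statement's English description precedes it below -/
import Mathlib

section
/- Let M : ℝⁿ × ℝᵐ → ℝ be differentiable and μ-strongly convex–strongly concave on a convex product set S = S_x × S_y with μ > 0. If (x′,y′) ∈ S satisfies ∇M(x′,y′) = 0, then every (x,y) ∈ S satisfies ‖(x − x′, y − y′)‖ ≤ ‖∇M(x,y)‖ / μ. -/
open Filter Topology Metric
open scoped RealInnerProductSpace

noncomputable section

abbrev Eu (n : ℕ) : Type := EuclideanSpace ℝ (Fin n)

noncomputable def gradx {n m : ℕ} (L : Eu n × Eu m → ℝ) (z : Eu n × Eu m) : Eu n :=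
  gradient (fun u => L (u, z.2)) z.1

noncomputable def grady {n m : ℕ} (L : Eu n × Eu m → ℝ) (z : Eu n × Eu m) : Eu m :=
  gradient (fun v => L (z.1, v)) z.2

noncomputable def Hxx {n m : ℕ} (L : Eu n × Eu m → ℝ) (z : Eu n × Eu m) : Eu n →L[ℝ] Eu n :=
  fderiv ℝ (fun x => gradient (fun u => L (u, z.2)) x) z.1

noncomputable def Hxy {n m : ℕ} (L : Eu n × Eu m → ℝ) (z : Eu n × Eu m) : Eu m →L[ℝ] Eu n :=
  fderiv ℝ (fun y => gradient (fun u => L (u, y)) z.1) z.2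

noncomputable def Hyx {n m : ℕ} (L : Eu n × Eu m → ℝ) (z : Eu n × Eu m) : Eu n →L[ℝ] Eu m :=
  fderiv ℝ (fun x => gradient (fun v => L (x, v)) z.2) z.1

noncomputable def Hyy {n m : ℕ} (L : Eu n × Eu m → ℝ) (z : Eu n × Eu m) : Eu m →L[ℝ] Eu m :=
  fderiv ℝ (fun y => gradient (fun v => L (z.1, v)) y) z.2

def WeaklyConvexConcave {n m : ℕ} (ρ : ℝ) (L : Eu n × Eu m → ℝ) : Prop :=
  ∀ z : Eu n × Eu m,
    (∀ v : Eu n, -ρ * ‖v‖ ^ 2 ≤ ⟪(Hxx L z) v, v⟫) ∧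
    (∀ w : Eu m, ⟪(Hyy L z) w, w⟫ ≤ ρ * ‖w‖ ^ 2)

def IntDomX {n m : ℕ} (η α : ℝ) (L : Eu n × Eu m → ℝ) : Prop :=
  ∀ z : Eu n × Eu m, ∀ v : Eu n,
    α * ‖v‖ ^ 2 ≤
      ⟪(Hxx L z) v +
        (Hxy L z) ((Ring.inverse (η • (1 : Eu m →L[ℝ] Eu m) - Hyy L z)) ((Hyx L z) v)), v⟫

def IntDomY {n m : ℕ} (η α : ℝ) (L : Eu n × Eu m → ℝ) : Prop :=
  ∀ z : Eu n × Eu m, ∀ w : Eu m,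
    α * ‖w‖ ^ 2 ≤
      ⟪-((Hyy L z) w) +
        (Hyx L z) ((Ring.inverse (η • (1 : Eu n →L[ℝ] Eu n) + Hxx L z)) ((Hxy L z) w)), w⟫

noncomputable def proxObj {n m : ℕ} (η : ℝ) (L : Eu n × Eu m → ℝ) (z w : Eu n × Eu m) : ℝ :=
  L w + η / 2 * ‖w.1 - z.1‖ ^ 2 - η / 2 * ‖w.2 - z.2‖ ^ 2

def IsProxPoint {n m : ℕ} (η : ℝ) (L : Eu n × Eu m → ℝ) (z w : Eu n × Eu m) : Prop :=
  (∀ v : Eu m, proxObj η L z (w.1, v) ≤ proxObj η L z w) ∧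
  (∀ u : Eu n, proxObj η L z w ≤ proxObj η L z (u, w.2))

noncomputable def saddleEnv {n m : ℕ} (η : ℝ) (L : Eu n × Eu m → ℝ)
    (prox : Eu n × Eu m → Eu n × Eu m) (z : Eu n × Eu m) : ℝ :=
  proxObj η L z (prox z)

noncomputable def moreau {n : ℕ} (η : ℝ) (f : Eu n → ℝ) (x : Eu n) : ℝ :=
  ⨅ u : Eu n, (f u + η / 2 * ‖u - x‖ ^ 2)

noncomputable def lyap {n m : ℕ} (η : ℝ) (L : Eu n × Eu m → ℝ) (z : Eu n × Eu m) : ℝ :=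
  -(moreau η (fun v => -L (z.1, v)) z.2) - moreau η (fun u => L (u, z.2)) z.1

noncomputable def hessForm {n m : ℕ} (L : Eu n × Eu m → ℝ) (z v w : Eu n × Eu m) : ℝ :=
  ⟪(Hxx L z) v.1, w.1⟫ + ⟪(Hxy L z) v.2, w.1⟫ + ⟪(Hyx L z) v.1, w.2⟫ + ⟪(Hyy L z) v.2, w.2⟫

/-- First-order lower bound for a differentiable strongly convex function. -/
theorem strongly_convex_first_order {E : Type*} [NormedAddCommGroup E] [InnerProductSpace ℝ E]
    [CompleteSpace E] {f : E → ℝ} {S : Set E} {μ : ℝ}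
    (hc : ConvexOn ℝ S (fun x => f x - μ / 2 * ‖x‖ ^ 2)) {a b : E} (ha : a ∈ S) (hb : b ∈ S)
    (hf : DifferentiableAt ℝ f a) :
    f a + ⟪gradient f a, b - a⟫ + μ / 2 * ‖b - a‖ ^ 2 ≤ f b := by
  have hline : HasDerivAt (fun t : ℝ => a + t • (b - a)) (b - a) 0 := by
    simpa using ((hasDerivAt_id (0 : ℝ)).smul_const (b - a)).const_add a
  have hf' : HasDerivAt (fun t : ℝ => f (a + t • (b - a))) ⟪gradient f a, b - a⟫ 0 := by
    have h : HasFDerivAt f (InnerProductSpace.toDual ℝ E (gradient f a))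
        (a + (0 : ℝ) • (b - a)) := by
      simpa using hf.hasGradientAt.hasFDerivAt
    simpa [Function.comp_def] using h.comp_hasDerivAt (0 : ℝ) hline
  have hd : HasDerivAt (fun t : ℝ => f (a + t • (b - a)) - μ / 2 * ‖a + t • (b - a)‖ ^ 2)
      (⟪gradient f a, b - a⟫ - μ / 2 * (2 * ⟪a, b - a⟫)) 0 := by
    have h := hf'.sub (hline.norm_sq.const_mul (μ / 2))
    rw [zero_smul, add_zero] at h
    exact h
  have hcl := hc.comp_affineMap (AffineMap.lineMap (k := ℝ) a b)
  have hcl' : ConvexOn ℝ (AffineMap.lineMap (k := ℝ) a b ⁻¹' S)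
      (fun t : ℝ => f (a + t • (b - a)) - μ / 2 * ‖a + t • (b - a)‖ ^ 2) := by
    refine hcl.congr fun t _ => ?_
    simp [AffineMap.lineMap_apply, add_comm]
  have h := hcl'.le_slope_of_hasDerivAt (x := 0) (y := 1) (by simpa using ha) (by simpa using hb)
    one_pos hd
  simp only [slope_def_field, one_smul, zero_smul, add_zero, add_sub_cancel, sub_zero,
    div_one] at h
  have hn : ‖b - a‖ ^ 2 = ‖b‖ ^ 2 - ‖a‖ ^ 2 - 2 * ⟪a, b - a⟫ := by
    have := norm_add_sq_real a (b - a)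
    rw [add_sub_cancel] at this
    linarith
  rw [hn]
  linarith

/-- First-order upper bound for a differentiable strongly concave function. -/
theorem strongly_concave_first_order {E : Type*} [NormedAddCommGroup E] [InnerProductSpace ℝ E]
    [CompleteSpace E] {f : E → ℝ} {S : Set E} {μ : ℝ}
    (hc : ConcaveOn ℝ S (fun x => f x + μ / 2 * ‖x‖ ^ 2)) {a b : E} (ha : a ∈ S) (hb : b ∈ S)
    (hf : DifferentiableAt ℝ f a) :
    f b ≤ f a + ⟪gradient f a, b - a⟫ - μ / 2 * ‖b - a‖ ^ 2 := by
  have hc' : ConvexOn ℝ S (fun x => (-f) x - μ / 2 * ‖x‖ ^ 2) := by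
    refine hc.neg.congr fun x _ => ?_
    simp only [Pi.neg_apply]
    ring
  have h := strongly_convex_first_order hc' ha hb hf.neg
  have hg : gradient (-f) a = -gradient f a := by
    simp [gradient, fderiv_neg]
  rw [hg, inner_neg_left] at h
  simp only [Pi.neg_apply] at h
  linarith

/-- distance to a stationary point of a μ-strongly convex–strongly
concave function is bounded by the gradient norm over μ. -/
theorem statement1 {n m : ℕ}
    (M : Eu n × Eu m → ℝ)
    (Sx : Set (Eu n)) (Sy : Set (Eu m)) (μ : ℝ) (hμ : 0 < μ)
    (hM : Differentiable ℝ M)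
    (hSx : Convex ℝ Sx) (hSy : Convex ℝ Sy)
    (hconv : ∀ y ∈ Sy, ConvexOn ℝ Sx (fun x => M (x, y) - μ / 2 * ‖x‖ ^ 2))
    (hconc : ∀ x ∈ Sx, ConcaveOn ℝ Sy (fun y => M (x, y) + μ / 2 * ‖y‖ ^ 2))
    (x' : Eu n) (y' : Eu m) (hx' : x' ∈ Sx) (hy' : y' ∈ Sy)
    (hstat : gradx M (x', y') = 0 ∧ grady M (x', y') = 0) :
    ∀ x ∈ Sx, ∀ y ∈ Sy,
      Real.sqrt (‖x - x'‖ ^ 2 + ‖y - y'‖ ^ 2) ≤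
        Real.sqrt (‖gradx M (x, y)‖ ^ 2 + ‖grady M (x, y)‖ ^ 2) / μ := by
  intro x hx y hy
  have hdx : ∀ u v, DifferentiableAt ℝ (fun u => M (u, v)) u := fun u v =>
    (hM (u, v)).comp u (differentiableAt_id.prodMk (differentiableAt_const v))
  have hdy : ∀ u v, DifferentiableAt ℝ (fun v => M (u, v)) v := fun u v =>
    (hM (u, v)).comp v ((differentiableAt_const u).prodMk differentiableAt_id)
  have h1 : M (x, y) + ⟪gradx M (x, y), x' - x⟫ + μ / 2 * ‖x' - x‖ ^ 2 ≤ M (x', y) :=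
    strongly_convex_first_order (hconv y hy) hx hx' (hdx x y)
  have h2 : M (x, y') ≤ M (x, y) + ⟪grady M (x, y), y' - y⟫ - μ / 2 * ‖y' - y‖ ^ 2 :=
    strongly_concave_first_order (hconc x hx) hy hy' (hdy x y)
  have h3 : M (x', y') + ⟪gradx M (x', y'), x - x'⟫ + μ / 2 * ‖x - x'‖ ^ 2 ≤ M (x, y') :=
    strongly_convex_first_order (hconv y' hy') hx' hx (hdx x' y')
  have h4 : M (x', y) ≤ M (x', y') + ⟪grady M (x', y'), y - y'⟫ - μ / 2 * ‖y - y'‖ ^ 2 :=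
    strongly_concave_first_order (hconc x' hx') hy' hy (hdy x' y')
  rw [hstat.1, inner_zero_left] at h3
  rw [hstat.2, inner_zero_left] at h4
  rw [norm_sub_rev x' x] at h1
  rw [norm_sub_rev y' y] at h2
  have h5 := neg_le_of_abs_le (abs_real_inner_le_norm (gradx M (x, y)) (x' - x))
  have h6 := le_of_abs_le (abs_real_inner_le_norm (grady M (x, y)) (y' - y))
  rw [norm_sub_rev x' x] at h5
  rw [norm_sub_rev y' y] at h6
  set p := ‖x - x'‖
  set q := ‖y - y'‖
  set g := ‖gradx M (x, y)‖
  set k := ‖grady M (x, y)‖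
  have hmono : μ * (p ^ 2 + q ^ 2) ≤ g * p + k * q := by linarith
  rw [le_div_iff₀ hμ]
  apply Real.le_sqrt_of_sq_le
  rw [mul_pow, Real.sq_sqrt (by positivity)]
  nlinarith [sq_nonneg (g - μ * p), sq_nonneg (k - μ * q)]

end
end

section
/- Let M : ℝⁿ × ℝᵐ → ℝ be continuously differentiable, and suppose M is β-smooth (its gradient is β-Lipschitz) and μ-strongly convex–strongly concave on the product of closed balls B(x₀,r) × B(y₀,r), where μ > 0 and r ≥ 2‖∇M(x₀,y₀)‖/μ. Then for any step size s ∈ (0, 2μ/β²), there exists a stationary point (x*,y*) of M in the closed ball of radius r/2 around (x₀,y₀) such that the gradient descent ascent iterates started at (x₀,y₀) satisfy ‖(x_k − x*, y_k − y*)‖² ≤ (1 − 2μs + β²s²)^k · ‖(x₀ − x*, y₀ − y*)‖² for all k, and in particular they converge linearly to (x*,y*). -/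
open Filter Topology Metric
open scoped RealInnerProductSpace

noncomputable section

section MonotoneOperator

variable {H : Type*} [NormedAddCommGroup H] [InnerProductSpace ℝ H]

theorem norm_forward_step_sub_sq_le {F : H → H} {μ β s : ℝ} {z w : H} (hs : 0 ≤ s)
    (hmono : μ * ‖z - w‖ ^ 2 ≤ ⟪F z - F w, z - w⟫) (hlip : ‖F z - F w‖ ≤ β * ‖z - w‖) :
    ‖(z - s • F z) - (w - s • F w)‖ ^ 2 ≤
      (1 - 2 * μ * s + β ^ 2 * s ^ 2) * ‖z - w‖ ^ 2 := by
  have heq : (z - s • F z) - (w - s • F w) = (z - w) - s • (F z - F w) := by module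
  have hsq : ‖F z - F w‖ ^ 2 ≤ (β * ‖z - w‖) ^ 2 := pow_le_pow_left₀ (norm_nonneg _) hlip 2
  rw [heq, norm_sub_sq_real, inner_smul_right, norm_smul, Real.norm_eq_abs, mul_pow, sq_abs,
    real_inner_comm]
  nlinarith [mul_le_mul_of_nonneg_left hmono hs, mul_le_mul_of_nonneg_left hsq (sq_nonneg s)]

theorem strong_monotone_const_le_lipschitz_const {F : H → H} {μ β : ℝ} {z w : H} (hne : z ≠ w)
    (hmono : μ * ‖z - w‖ ^ 2 ≤ ⟪F z - F w, z - w⟫) (hlip : ‖F z - F w‖ ≤ β * ‖z - w‖) :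
    μ ≤ β := by
  have hd : 0 < ‖z - w‖ := norm_pos_iff.2 (sub_ne_zero.2 hne)
  have hcs := real_inner_le_norm (F z - F w) (z - w)
  have hle : μ * ‖z - w‖ ^ 2 ≤ β * ‖z - w‖ ^ 2 := by
    nlinarith [mul_le_mul_of_nonneg_right hlip hd.le]
  exact le_of_mul_le_mul_right hle (by positivity)

theorem norm_sub_le_of_zero_of_strong_monotone {F : H → H} {μ : ℝ} {z w : H} (hμ : 0 < μ)
    (hz : F z = 0) (hmono : μ * ‖z - w‖ ^ 2 ≤ ⟪F z - F w, z - w⟫) :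
    ‖z - w‖ ≤ ‖F w‖ / μ := by
  have hcs := real_inner_le_norm (F z - F w) (z - w)
  rw [hz, zero_sub, norm_neg] at hcs
  rw [hz, zero_sub] at hmono
  rcases (norm_nonneg (z - w)).eq_or_lt with h | h
  · rw [← h]; positivity
  · rw [le_div_iff₀ hμ]
    refine le_of_mul_le_mul_right ?_ h
    nlinarith

theorem exists_zero_of_strong_monotone_of_lipschitz_on_closedBall [CompleteSpace H]
    {F : H → H} {μ β r : ℝ} {z₀ : H} (hμ : 0 < μ) (hμβ : μ ≤ β)
    (hmono : ∀ z ∈ closedBall z₀ r, ∀ w ∈ closedBall z₀ r,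
      μ * ‖z - w‖ ^ 2 ≤ ⟪F z - F w, z - w⟫)
    (hlip : ∀ z ∈ closedBall z₀ r, ∀ w ∈ closedBall z₀ r, ‖F z - F w‖ ≤ β * ‖z - w‖)
    (hr : 2 * ‖F z₀‖ / μ ≤ r) :
    ∃ z ∈ closedBall z₀ r, F z = 0 := by
  have hβ : 0 < β := hμ.trans_le hμβ
  have hr0 : 0 ≤ r := le_trans (by positivity) hr
  have hz₀ : z₀ ∈ closedBall z₀ r := mem_closedBall_self hr0
  set t : ℝ := μ / β ^ 2 with ht
  have ht0 : 0 < t := by positivity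
  have hβt : β ^ 2 * t = μ := by rw [ht]; field_simp
  have hμt : μ * t ≤ 1 := by
    rw [ht, ← mul_div_assoc, div_le_one (by positivity)]
    nlinarith
  set q : ℝ := 1 - μ * t / 2 with hq
  have hq0 : 0 ≤ q := by linarith
  have hstep : ∀ z ∈ closedBall z₀ r, ∀ w ∈ closedBall z₀ r,
      ‖(z - t • F z) - (w - t • F w)‖ ≤ q * ‖z - w‖ := by
    intro z hz w hw
    refine le_of_sq_le_sq ?_ (by positivity)
    refine (norm_forward_step_sub_sq_le ht0.le (hmono z hz w hw) (hlip z hz w hw)).trans ?_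
    rw [mul_pow]
    gcongr
    rw [hq]
    nlinarith [sq_nonneg (μ * t)]
  have hmaps : Set.MapsTo (fun z => z - t • F z) (closedBall z₀ r) (closedBall z₀ r) := by
    intro z hz
    have hzr : ‖z - z₀‖ ≤ r := mem_closedBall_iff_norm.1 hz
    have hg : ‖F z₀‖ ≤ μ * r / 2 := by
      rw [div_le_iff₀ hμ] at hr
      linarith
    rw [mem_closedBall_iff_norm]
    calc ‖z - t • F z - z₀‖
        = ‖((z - t • F z) - (z₀ - t • F z₀)) - t • F z₀‖ := by congr 1; module
      _ ≤ q * ‖z - z₀‖ + t * ‖F z₀‖ := by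
          refine (norm_sub_le _ _).trans (add_le_add (hstep z hz z₀ hz₀) ?_)
          rw [norm_smul, Real.norm_of_nonneg ht0.le]
      _ ≤ q * r + t * (μ * r / 2) := by gcongr
      _ = r := by rw [hq]; ring
  have hcontr : ContractingWith q.toNNReal (hmaps.restrict _ _ _) := by
    refine ⟨?_, LipschitzWith.of_dist_le_mul fun z w => ?_⟩
    · rw [Real.toNNReal_lt_one]
      have : 0 < μ * t := by positivity
      linarith
    · rw [Subtype.dist_eq, Subtype.dist_eq, dist_eq_norm, dist_eq_norm, Real.coe_toNNReal q hq0]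
      exact hstep z z.2 w w.2
  obtain ⟨z, hz, hfix, -⟩ :=
    hcontr.exists_fixedPoint' isClosed_closedBall.isComplete hmaps hz₀ (edist_ne_top _ _)
  refine ⟨z, hz, ?_⟩
  have hsm : t • F z = 0 := sub_eq_self.1 hfix
  exact (smul_eq_zero.1 hsm).resolve_left ht0.ne'

theorem exists_zero_forward_iterates_linear_convergence [CompleteSpace H]
    {F : H → H} {μ β r s : ℝ} {z₀ : H} (hμ : 0 < μ)
    (hmono : ∀ z ∈ closedBall z₀ r, ∀ w ∈ closedBall z₀ r,
      μ * ‖z - w‖ ^ 2 ≤ ⟪F z - F w, z - w⟫)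
    (hlip : ∀ z ∈ closedBall z₀ r, ∀ w ∈ closedBall z₀ r, ‖F z - F w‖ ≤ β * ‖z - w‖)
    (hr : 2 * ‖F z₀‖ / μ ≤ r) (hs0 : 0 < s) (hs : s < 2 * μ / β ^ 2)
    {z : ℕ → H} (hz0 : z 0 = z₀) (hz : ∀ k, z (k + 1) = z k - s • F (z k)) :
    ∃ zs : H, ‖zs - z₀‖ ≤ r / 2 ∧ F zs = 0 ∧
      (∀ k, ‖z k - zs‖ ^ 2 ≤ (1 - 2 * μ * s + β ^ 2 * s ^ 2) ^ k * ‖z₀ - zs‖ ^ 2) ∧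
      Tendsto z atTop (𝓝 zs) := by
  have hr0 : 0 ≤ r := le_trans (by positivity) hr
  have hz₀ : z₀ ∈ closedBall z₀ r := mem_closedBall_self hr0
  by_cases hF : F z₀ = 0
  · have hconst : ∀ k, z k = z₀ := by
      intro k
      induction k with
      | zero => exact hz0
      | succ k ih => rw [hz, ih, hF, smul_zero, sub_zero]
    refine ⟨z₀, by rw [sub_self, norm_zero]; positivity, hF, fun k => by simp [hconst k], ?_⟩
    rw [funext hconst]
    exact tendsto_const_nhds
  have hFpos : 0 < ‖F z₀‖ := norm_pos_iff.2 hF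
  have hrpos : 0 < r := lt_of_lt_of_le (by positivity) hr
  have hμβ : μ ≤ β := by
    have hmem : z₀ + (r / ‖F z₀‖) • F z₀ ∈ closedBall z₀ r := by
      rw [mem_closedBall_iff_norm, add_sub_cancel_left, norm_smul,
        Real.norm_of_nonneg (by positivity), div_mul_cancel₀ _ hFpos.ne']
    refine strong_monotone_const_le_lipschitz_const ?_ (hmono _ hmem _ hz₀) (hlip _ hmem _ hz₀)
    rw [Ne, add_eq_left, smul_eq_zero, not_or]
    exact ⟨by positivity, hF⟩
  have hβ : 0 < β := hμ.trans_le hμβ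
  obtain ⟨zs, hzs, hFzs⟩ :=
    exists_zero_of_strong_monotone_of_lipschitz_on_closedBall hμ hμβ hmono hlip hr
  have hdist : ‖zs - z₀‖ ≤ r / 2 := by
    refine (norm_sub_le_of_zero_of_strong_monotone hμ hFzs (hmono _ hzs _ hz₀)).trans ?_
    rw [mul_div_assoc] at hr
    linarith
  set c : ℝ := 1 - 2 * μ * s + β ^ 2 * s ^ 2 with hc
  have hc0 : 0 ≤ c := by
    rw [hc]
    nlinarith [sq_nonneg (1 - μ * s), mul_le_mul_of_nonneg_right
      (pow_le_pow_left₀ hμ.le hμβ 2) (sq_nonneg s)]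
  have hc1 : c < 1 := by
    rw [lt_div_iff₀ (by positivity)] at hs
    nlinarith [mul_lt_mul_of_pos_right hs hs0]
  have hrate : ∀ k, ‖z k - zs‖ ^ 2 ≤ c ^ k * ‖z₀ - zs‖ ^ 2 := by
    intro k
    induction k with
    | zero => simp [hz0]
    | succ k ih =>
      have hk : ‖z k - zs‖ ≤ ‖z₀ - zs‖ := by
        refine le_of_sq_le_sq (ih.trans ?_) (norm_nonneg _)
        exact mul_le_of_le_one_left (sq_nonneg _) (pow_le_one₀ hc0 hc1.le)
      have hmem : z k ∈ closedBall z₀ r := by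
        rw [mem_closedBall_iff_norm]
        have htri := norm_sub_le_norm_sub_add_norm_sub (z k) zs z₀
        rw [norm_sub_rev z₀ zs] at hk
        linarith
      have hstep := norm_forward_step_sub_sq_le hs0.le (hmono _ hmem _ hzs) (hlip _ hmem _ hzs)
      rw [hFzs, smul_zero, sub_zero] at hstep
      rw [hz, pow_succ' c, mul_assoc]
      exact hstep.trans (mul_le_mul_of_nonneg_left ih hc0)
  refine ⟨zs, hdist, hFzs, hrate, ?_⟩
  rw [tendsto_iff_norm_sub_tendsto_zero]
  have hbound : Tendsto (fun k => c ^ k * ‖z₀ - zs‖ ^ 2) atTop (𝓝 0) := by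
    simpa using (tendsto_pow_atTop_nhds_zero_of_lt_one hc0 hc1).mul_const (‖z₀ - zs‖ ^ 2)
  have hsq := squeeze_zero (fun k => sq_nonneg ‖z k - zs‖) hrate hbound
  simpa [Real.sqrt_sq] using hsq.sqrt

end MonotoneOperator

section StronglyConvex

variable {E : Type*} [NormedAddCommGroup E] [InnerProductSpace ℝ E]

theorem ConvexOn.add_apply_fderiv_le {f : E → ℝ} {S : Set E} {f' : E →L[ℝ] ℝ} {x y : E}
    (hf : ConvexOn ℝ S f) (hx : x ∈ S) (hy : y ∈ S) (hd : HasFDerivAt f f' x) :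
    f x + f' (y - x) ≤ f y := by
  have hline : HasDerivAt (f ∘ AffineMap.lineMap x y) (f' (y - x)) (0 : ℝ) :=
    HasFDerivAt.comp_hasDerivAt (0 : ℝ) (by simpa using hd) AffineMap.hasDerivAt_lineMap
  have hslope := (hf.comp_affineMap (AffineMap.lineMap (k := ℝ) x y)).le_slope_of_hasDerivAt
    (by simpa using hx) (by simpa using hy) zero_lt_one hline
  simp only [slope_def_field, Function.comp_apply, AffineMap.lineMap_apply_zero,
    AffineMap.lineMap_apply_one, sub_zero, div_one] at hslope
  linarith

theorem ConvexOn.add_inner_gradient_add_sq_le [CompleteSpace E] {f : E → ℝ} {S : Set E} {μ : ℝ}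
    {x y : E} (hf : ConvexOn ℝ S fun u => f u - μ / 2 * ‖u‖ ^ 2) (hx : x ∈ S) (hy : y ∈ S)
    (hd : DifferentiableAt ℝ f x) :
    f x + ⟪gradient f x, y - x⟫ + μ / 2 * ‖y - x‖ ^ 2 ≤ f y := by
  have hle := hf.add_apply_fderiv_le hx hy
    (hd.hasGradientAt.hasFDerivAt.sub (((hasStrictFDerivAt_norm_sq x).hasFDerivAt).const_mul (μ / 2)))
  simp only [sub_apply, smul_apply, InnerProductSpace.toDual_apply_apply,
    innerSL_apply_apply, smul_eq_mul, nsmul_eq_mul, Nat.cast_ofNat, inner_sub_right x,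
    real_inner_self_eq_norm_sq] at hle
  rw [norm_sub_sq_real, real_inner_comm x y]
  linarith

theorem ConcaveOn.le_add_inner_gradient_sub_sq [CompleteSpace E] {f : E → ℝ} {S : Set E} {μ : ℝ}
    {x y : E} (hf : ConcaveOn ℝ S fun u => f u + μ / 2 * ‖u‖ ^ 2) (hx : x ∈ S) (hy : y ∈ S)
    (hd : DifferentiableAt ℝ f x) :
    f y ≤ f x + ⟪gradient f x, y - x⟫ - μ / 2 * ‖y - x‖ ^ 2 := by
  have hneg : ConvexOn ℝ S fun u => -f u - μ / 2 * ‖u‖ ^ 2 := by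
    refine hf.neg.congr fun u _ => ?_
    simp only [Pi.neg_apply]
    ring
  have hgrad : gradient (fun u => -f u) x = -gradient f x := by
    simp [gradient, fderiv_fun_neg]
  have hle := hneg.add_inner_gradient_add_sq_le hx hy hd.fun_neg
  rw [hgrad, inner_neg_left] at hle
  linarith

end StronglyConvex

theorem strong_monotone_of_strongly_convex_concave {n m : ℕ} {M : Eu n × Eu m → ℝ} {μ : ℝ}
    {A : Set (Eu n)} {B : Set (Eu m)} (hM : Differentiable ℝ M)
    (hconv : ∀ y ∈ B, ConvexOn ℝ A (fun x => M (x, y) - μ / 2 * ‖x‖ ^ 2))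
    (hconc : ∀ x ∈ A, ConcaveOn ℝ B (fun y => M (x, y) + μ / 2 * ‖y‖ ^ 2))
    {z w : Eu n × Eu m} (hz₁ : z.1 ∈ A) (hz₂ : z.2 ∈ B) (hw₁ : w.1 ∈ A) (hw₂ : w.2 ∈ B) :
    μ * (‖z.1 - w.1‖ ^ 2 + ‖z.2 - w.2‖ ^ 2) ≤
      ⟪gradx M z - gradx M w, z.1 - w.1⟫ - ⟪grady M z - grady M w, z.2 - w.2⟫ := by
  have hdx (v : Eu n × Eu m) : DifferentiableAt ℝ (fun u => M (u, v.2)) v.1 := by fun_prop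
  have hdy (v : Eu n × Eu m) : DifferentiableAt ℝ (fun u => M (v.1, u)) v.2 := by fun_prop
  have h₁ := (hconv z.2 hz₂).add_inner_gradient_add_sq_le hz₁ hw₁ (hdx z)
  have h₂ := (hconv w.2 hw₂).add_inner_gradient_add_sq_le hw₁ hz₁ (hdx w)
  have h₃ := (hconc z.1 hz₁).le_add_inner_gradient_sub_sq hz₂ hw₂ (hdy z)
  have h₄ := (hconc w.1 hw₁).le_add_inner_gradient_sub_sq hw₂ hz₂ (hdy w)
  simp only [gradx, grady, inner_sub_left]
  rw [← neg_sub z.1 w.1, inner_neg_right, norm_neg] at h₁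
  rw [← neg_sub z.2 w.2, inner_neg_right, norm_neg] at h₃
  linarith

def gdaOperator {n m : ℕ} (M : Eu n × Eu m → ℝ) (z : WithLp 2 (Eu n × Eu m)) :
    WithLp 2 (Eu n × Eu m) :=
  WithLp.toLp 2 (gradx M z.ofLp, -grady M z.ofLp)

/-- linear convergence of gradient descent ascent for a locally
smooth, locally strongly convex–strongly concave function. -/
theorem statement2 {n m : ℕ}
    (M : Eu n × Eu m → ℝ) (μ β r s : ℝ)
    (x₀ : Eu n) (y₀ : Eu m)
    (hμ : 0 < μ)
    (hM : ContDiff ℝ 1 M)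
    (hsmooth : ∀ z z' : Eu n × Eu m,
      z.1 ∈ Metric.closedBall x₀ r → z.2 ∈ Metric.closedBall y₀ r →
      z'.1 ∈ Metric.closedBall x₀ r → z'.2 ∈ Metric.closedBall y₀ r →
      Real.sqrt (‖gradx M z - gradx M z'‖ ^ 2 + ‖grady M z - grady M z'‖ ^ 2) ≤
        β * Real.sqrt (‖z.1 - z'.1‖ ^ 2 + ‖z.2 - z'.2‖ ^ 2))
    (hconv : ∀ y ∈ Metric.closedBall y₀ r,
      ConvexOn ℝ (Metric.closedBall x₀ r) (fun x => M (x, y) - μ / 2 * ‖x‖ ^ 2))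
    (hconc : ∀ x ∈ Metric.closedBall x₀ r,
      ConcaveOn ℝ (Metric.closedBall y₀ r) (fun y => M (x, y) + μ / 2 * ‖y‖ ^ 2))
    (hr : 2 * Real.sqrt (‖gradx M (x₀, y₀)‖ ^ 2 + ‖grady M (x₀, y₀)‖ ^ 2) / μ ≤ r)
    (hs0 : 0 < s) (hs : s < 2 * μ / β ^ 2)
    (x : ℕ → Eu n) (y : ℕ → Eu m) (hx0 : x 0 = x₀) (hy0 : y 0 = y₀)
    (hGDA : ∀ k, x (k + 1) = x k - s • gradx M (x k, y k) ∧
                 y (k + 1) = y k + s • grady M (x k, y k)) :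
    ∃ xs : Eu n, ∃ ys : Eu m,
      Real.sqrt (‖xs - x₀‖ ^ 2 + ‖ys - y₀‖ ^ 2) ≤ r / 2 ∧
      gradx M (xs, ys) = 0 ∧ grady M (xs, ys) = 0 ∧
      (∀ k, ‖x k - xs‖ ^ 2 + ‖y k - ys‖ ^ 2 ≤
        (1 - 2 * μ * s + β ^ 2 * s ^ 2) ^ k * (‖x₀ - xs‖ ^ 2 + ‖y₀ - ys‖ ^ 2)) ∧
      Tendsto (fun k => (x k, y k)) atTop (𝓝 (xs, ys)) := by
  have hmem : ∀ z ∈ closedBall (WithLp.toLp 2 (x₀, y₀)) r,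
      z.ofLp.1 ∈ closedBall x₀ r ∧ z.ofLp.2 ∈ closedBall y₀ r := by
    intro z hz
    rw [mem_closedBall_iff_norm] at hz
    rw [mem_closedBall_iff_norm, mem_closedBall_iff_norm]
    exact ⟨(WithLp.norm_fst_le _ (z - WithLp.toLp 2 (x₀, y₀))).trans hz,
      (WithLp.norm_snd_le _ (z - WithLp.toLp 2 (x₀, y₀))).trans hz⟩
  have hmono : ∀ z ∈ closedBall (WithLp.toLp 2 (x₀, y₀)) r,
      ∀ w ∈ closedBall (WithLp.toLp 2 (x₀, y₀)) r,
      μ * ‖z - w‖ ^ 2 ≤ ⟪gdaOperator M z - gdaOperator M w, z - w⟫ := by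
    intro z hz w hw
    have h := strong_monotone_of_strongly_convex_concave (hM.differentiable one_ne_zero)
      hconv hconc (hmem z hz).1 (hmem z hz).2 (hmem w hw).1 (hmem w hw).2
    rw [WithLp.prod_norm_sq_eq_of_L2, WithLp.prod_inner_apply]
    refine h.trans_eq ?_
    simp only [gdaOperator, WithLp.ofLp_sub, Prod.fst_sub, Prod.snd_sub]
    rw [← neg_sub', inner_neg_left, sub_eq_add_neg]
  have hlip : ∀ z ∈ closedBall (WithLp.toLp 2 (x₀, y₀)) r,
      ∀ w ∈ closedBall (WithLp.toLp 2 (x₀, y₀)) r,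
      ‖gdaOperator M z - gdaOperator M w‖ ≤ β * ‖z - w‖ := by
    intro z hz w hw
    have h := hsmooth z.ofLp w.ofLp (hmem z hz).1 (hmem z hz).2 (hmem w hw).1 (hmem w hw).2
    rw [WithLp.prod_norm_eq_of_L2, WithLp.prod_norm_eq_of_L2]
    refine le_of_eq_of_le ?_ h
    simp only [gdaOperator, WithLp.sub_fst, WithLp.sub_snd, WithLp.toLp_fst, WithLp.toLp_snd]
    rw [← neg_sub', norm_neg]
  have hnorm : ‖gdaOperator M (WithLp.toLp 2 (x₀, y₀))‖ =
      Real.sqrt (‖gradx M (x₀, y₀)‖ ^ 2 + ‖grady M (x₀, y₀)‖ ^ 2) := by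
    simp [gdaOperator, WithLp.prod_norm_eq_of_L2]
  obtain ⟨zs, hball, hzero, hrate, hlim⟩ :=
    exists_zero_forward_iterates_linear_convergence (z := fun k => WithLp.toLp 2 (x k, y k))
      hμ hmono hlip (hnorm ▸ hr) hs0 hs (by simp [hx0, hy0]) (fun k => by
        rw [(hGDA k).1, (hGDA k).2]
        apply (WithLp.equiv 2 (Eu n × Eu m)).injective
        simp [gdaOperator])
  refine ⟨zs.fst, zs.snd, ?_, ?_, ?_, fun k => ?_, ?_⟩
  · rwa [WithLp.prod_norm_eq_of_L2] at hball
  · exact congrArg WithLp.fst hzero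
  · exact neg_eq_zero.1 (congrArg WithLp.snd hzero)
  · have h := hrate k
    rwa [WithLp.prod_norm_sq_eq_of_L2, WithLp.prod_norm_sq_eq_of_L2] at h
  · exact ((WithLp.prod_continuous_ofLp 2 (Eu n) (Eu m)).tendsto zs).comp hlim

end
end

section
/- Let L : ℝⁿ × ℝᵐ → ℝ be twice continuously differentiable and ρ-weakly convex–weakly concave, and let η > max(ρ, 0). Then for every z = (x,y), writing z₊ = (x₊,y₊) = prox_η(z), the saddle envelope L_η is differentiable at z with ∇_x L_η(z) = η(x − x₊) = ∇_x L(z₊) and ∇_y L_η(z) = η(y₊ − y) = ∇_y L(z₊). -/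
open Filter Topology Metric
open scoped RealInnerProductSpace

noncomputable section

section ProximalPoint

variable {E : Type*} [NormedAddCommGroup E] [InnerProductSpace ℝ E]

theorem norm_sub_sq_eq_add_sub_inner (u x x₀ : E) :
    ‖u - x‖ ^ 2 = ‖u - x₀‖ ^ 2 - 2 * ⟪u - x₀, x - x₀⟫ + ‖x - x₀‖ ^ 2 := by
  rw [← norm_sub_sq_real, sub_sub_sub_cancel_right]

variable [CompleteSpace E]

/-- A twice continuously differentiable `f` with `∇²f ⪰ -ρ I` lies above its tangent paraboloids
of curvature `-ρ`. -/
theorem add_inner_gradient_sub_le_of_hessian_ge {f : E → ℝ} {ρ : ℝ} (hf : ContDiff ℝ 2 f)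
    (hess : ∀ u v : E, -ρ * ‖v‖ ^ 2 ≤ ⟪fderiv ℝ (gradient f) u v, v⟫) (u₀ u : E) :
    f u₀ + ⟪gradient f u₀, u - u₀⟫ - ρ / 2 * ‖u - u₀‖ ^ 2 ≤ f u := by
  set d := u - u₀
  have hgrad : Differentiable ℝ (gradient f) := by
    have h1 : Differentiable ℝ (fderiv ℝ f) :=
      (hf.fderiv_right (m := 1) (by norm_num)).differentiable (by norm_num)
    exact (InnerProductSpace.toDual ℝ E).symm.differentiable.comp h1
  have hline (t : ℝ) : HasDerivAt (fun t : ℝ => u₀ + t • d) d t := by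
    simpa using ((hasDerivAt_id t).smul_const d).const_add u₀
  have hψ (t : ℝ) : HasDerivAt (fun t : ℝ => f (u₀ + t • d) + ρ / 2 * ‖d‖ ^ 2 * t ^ 2)
      (⟪gradient f (u₀ + t • d), d⟫ + ρ * ‖d‖ ^ 2 * t) t := by
    have h1 := ((hf.differentiable (by norm_num)) (u₀ + t • d)).hasFDerivAt.comp_hasDerivAt t
      (hline t)
    rw [← inner_gradient_left] at h1
    refine (h1.add ((hasDerivAt_pow 2 t).const_mul (ρ / 2 * ‖d‖ ^ 2))).congr_deriv ?_
    push_cast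
    ring
  have hψ' (t : ℝ) : HasDerivAt (fun t : ℝ => ⟪gradient f (u₀ + t • d), d⟫ + ρ * ‖d‖ ^ 2 * t)
      (⟪fderiv ℝ (gradient f) (u₀ + t • d) d, d⟫ + ρ * ‖d‖ ^ 2) t := by
    have h1 := ((hgrad (u₀ + t • d)).hasFDerivAt.comp_hasDerivAt t (hline t)).inner ℝ
      (hasDerivAt_const t d)
    refine (h1.add ((hasDerivAt_id t).const_mul (ρ * ‖d‖ ^ 2))).congr_deriv ?_
    simp
  have hderiv : deriv (fun t : ℝ => f (u₀ + t • d) + ρ / 2 * ‖d‖ ^ 2 * t ^ 2) =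
      fun t : ℝ => ⟪gradient f (u₀ + t • d), d⟫ + ρ * ‖d‖ ^ 2 * t :=
    funext fun t => (hψ t).deriv
  have hconv : ConvexOn ℝ Set.univ
      (fun t : ℝ => f (u₀ + t • d) + ρ / 2 * ‖d‖ ^ 2 * t ^ 2) := by
    refine convexOn_univ_of_deriv2_nonneg (fun t => (hψ t).differentiableAt) ?_ fun t => ?_
    · rw [hderiv]
      exact fun t => (hψ' t).differentiableAt
    · rw [Function.iterate_succ_apply, Function.iterate_one, hderiv, (hψ' t).deriv]
      linarith [hess (u₀ + t • d) d]
  have h := hconv.le_slope_of_hasDerivAt (Set.mem_univ 0) (Set.mem_univ 1) one_pos (hψ 0)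
  have hu : u₀ + d = u := add_sub_cancel u₀ u
  simp only [slope_def_field, zero_smul, one_smul, add_zero, hu, mul_zero, sub_zero, div_one,
    one_pow, mul_one, zero_pow two_ne_zero] at h
  linarith

/-- The first order condition for a proximal point. -/
theorem gradient_eq_of_forall_le_add_sq {f : E → ℝ} {η : ℝ} {x u₀ : E}
    (hf : DifferentiableAt ℝ f u₀)
    (hmin : ∀ u, f u₀ + η / 2 * ‖u₀ - x‖ ^ 2 ≤ f u + η / 2 * ‖u - x‖ ^ 2) :
    gradient f u₀ = η • (x - u₀) := by
  have hsq : HasFDerivAt (fun u => η / 2 * ‖u - x‖ ^ 2)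
      ((η / 2) • (2 • (innerSL ℝ (u₀ - x)).comp (ContinuousLinearMap.id ℝ E))) u₀ :=
    (((hasFDerivAt_id u₀).sub_const x).norm_sq).const_mul (η / 2)
  have hzero := IsLocalMin.hasFDerivAt_eq_zero (Eventually.of_forall hmin)
    (hf.hasFDerivAt.add hsq)
  refine ext_inner_right ℝ fun v => ?_
  have hv := DFunLike.congr_fun hzero v
  simp only [add_apply, smul_apply,
    ContinuousLinearMap.comp_apply, ContinuousLinearMap.id_apply, innerSL_apply_apply,
    zero_apply, smul_eq_mul, nsmul_eq_mul, Nat.cast_ofNat] at hv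
  rw [inner_gradient_left, real_inner_smul_left, ← neg_sub u₀ x, inner_neg_left]
  linarith

/-- Quadratic growth of the proximal objective at a proximal point. -/
theorem add_sq_le_of_forall_le_add_sq {f : E → ℝ} {ρ η : ℝ} {x u₀ : E} (hf : ContDiff ℝ 2 f)
    (hess : ∀ u v : E, -ρ * ‖v‖ ^ 2 ≤ ⟪fderiv ℝ (gradient f) u v, v⟫)
    (hmin : ∀ u, f u₀ + η / 2 * ‖u₀ - x‖ ^ 2 ≤ f u + η / 2 * ‖u - x‖ ^ 2) (u : E) :
    f u₀ + η / 2 * ‖u₀ - x‖ ^ 2 + (η - ρ) / 2 * ‖u - u₀‖ ^ 2 ≤ f u + η / 2 * ‖u - x‖ ^ 2 := by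
  have h := add_inner_gradient_sub_le_of_hessian_ge hf hess u₀ u
  rw [gradient_eq_of_forall_le_add_sq (hf.differentiable (by norm_num) u₀) hmin,
    real_inner_smul_left, real_inner_comm] at h
  have h1 := norm_sub_sq_eq_add_sub_inner u x u₀
  rw [norm_sub_rev u₀ x]
  linear_combination h + η / 2 * (-h1)

end ProximalPoint

theorem gradient_fun_neg {E : Type*} [NormedAddCommGroup E] [InnerProductSpace ℝ E]
    [CompleteSpace E] (f : E → ℝ) : gradient (fun v => -f v) = fun v => -gradient f v := by
  funext v
  simp [gradient, fderiv_fun_neg]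

section SaddleEnvelope

variable {n m : ℕ} {L : Eu n × Eu m → ℝ} {ρ η : ℝ} {z w : Eu n × Eu m}

theorem IsProxPoint.fst_le (h : IsProxPoint η L z w) (u : Eu n) :
    L (w.1, w.2) + η / 2 * ‖w.1 - z.1‖ ^ 2 ≤ L (u, w.2) + η / 2 * ‖u - z.1‖ ^ 2 := by
  have := h.2 u
  simp only [proxObj] at this
  linarith

theorem IsProxPoint.snd_le (h : IsProxPoint η L z w) (v : Eu m) :
    -L (w.1, w.2) + η / 2 * ‖w.2 - z.2‖ ^ 2 ≤ -L (w.1, v) + η / 2 * ‖v - z.2‖ ^ 2 := by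
  have := h.1 v
  simp only [proxObj] at this
  linarith

theorem IsProxPoint.gradx_eq (h : IsProxPoint η L z w) (hL : ContDiff ℝ 2 L) :
    gradx L w = η • (z.1 - w.1) :=
  gradient_eq_of_forall_le_add_sq (f := fun u => L (u, w.2))
    ((hL.comp (contDiff_prodMk_left w.2)).differentiable (by norm_num) w.1) h.fst_le

theorem IsProxPoint.grady_eq (h : IsProxPoint η L z w) (hL : ContDiff ℝ 2 L) :
    grady L w = η • (w.2 - z.2) := by
  have h1 := gradient_eq_of_forall_le_add_sq (f := fun v => -L (w.1, v))
    ((hL.comp (contDiff_prodMk_right w.1)).neg.differentiable (by norm_num) w.2) h.snd_le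
  rw [gradient_fun_neg, neg_eq_iff_eq_neg, ← smul_neg, neg_sub] at h1
  exact h1

/-- Quadratic growth of the gap of the proximal objective at a saddle point. -/
theorem IsProxPoint.sq_le_gap (h : IsProxPoint η L z w) (hL : ContDiff ℝ 2 L)
    (hweak : WeaklyConvexConcave ρ L) (w' : Eu n × Eu m) :
    (η - ρ) / 2 * (‖w'.1 - w.1‖ ^ 2 + ‖w'.2 - w.2‖ ^ 2) ≤
      proxObj η L z (w'.1, w.2) - proxObj η L z (w.1, w'.2) := by
  have hx := add_sq_le_of_forall_le_add_sq (ρ := ρ) (f := fun u => L (u, w.2))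
    (hL.comp (contDiff_prodMk_left w.2)) (fun u v => (hweak (u, w.2)).1 v) h.fst_le w'.1
  have hy := add_sq_le_of_forall_le_add_sq (ρ := ρ) (f := fun v => -L (w.1, v))
    (hL.comp (contDiff_prodMk_right w.1)).neg (fun v d => by
      have := (hweak (w.1, v)).2 d
      rw [gradient_fun_neg, fderiv_fun_neg, neg_apply, inner_neg_left, neg_mul]
      exact neg_le_neg this) h.snd_le w'.2
  simp only [proxObj]
  linarith

/-- Lipschitz continuity of the proximal operator. -/
theorem IsProxPoint.norm_sub_add_norm_sub_le (hL : ContDiff ℝ 2 L)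
    (hweak : WeaklyConvexConcave ρ L) (hρ : ρ < η) (hη : 0 ≤ η) {z' w' : Eu n × Eu m}
    (h : IsProxPoint η L z w) (h' : IsProxPoint η L z' w') :
    ‖w'.1 - w.1‖ + ‖w'.2 - w.2‖ ≤ 2 * (η / (η - ρ)) * ‖z' - z‖ := by
  have hgap := h.sq_le_gap hL hweak w'
  have hgap' := h'.sq_le_gap hL hweak w
  rw [norm_sub_rev w.1, norm_sub_rev w.2] at hgap'
  simp only [proxObj] at hgap hgap'
  have e1 := norm_sub_sq_eq_add_sub_inner w.1 z'.1 z.1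
  have e2 := norm_sub_sq_eq_add_sub_inner w'.1 z'.1 z.1
  have e3 := norm_sub_sq_eq_add_sub_inner w.2 z'.2 z.2
  have e4 := norm_sub_sq_eq_add_sub_inner w'.2 z'.2 z.2
  have i1 : ⟪w'.1 - w.1, z'.1 - z.1⟫ ≤ ‖w'.1 - w.1‖ * ‖z' - z‖ :=
    (real_inner_le_norm _ _).trans
      (mul_le_mul_of_nonneg_left (norm_fst_le (z' - z)) (norm_nonneg _))
  have i2 : ⟪w'.2 - w.2, z'.2 - z.2⟫ ≤ ‖w'.2 - w.2‖ * ‖z' - z‖ :=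
    (real_inner_le_norm _ _).trans
      (mul_le_mul_of_nonneg_left (norm_snd_le (z' - z)) (norm_nonneg _))
  rw [← sub_sub_sub_cancel_right w'.1 w.1 z.1, inner_sub_left, sub_sub_sub_cancel_right] at i1
  rw [← sub_sub_sub_cancel_right w'.2 w.2 z.2, inner_sub_left, sub_sub_sub_cancel_right] at i2
  have hμ : 0 < η - ρ := sub_pos.2 hρ
  have j1 := mul_le_mul_of_nonneg_left i1 hη
  have j2 := mul_le_mul_of_nonneg_left i2 hη
  rw [e1, e2, e3, e4] at hgap'
  set a := ‖w'.1 - w.1‖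
  set b := ‖w'.2 - w.2‖
  set r := ‖z' - z‖
  have ha : 0 ≤ a := norm_nonneg _
  have hb : 0 ≤ b := norm_nonneg _
  have hr : 0 ≤ r := norm_nonneg _
  have key : (η - ρ) * (a ^ 2 + b ^ 2) ≤ η * r * (a + b) := by linarith
  have key' : (a + b) * ((η - ρ) * (a + b)) ≤ (a + b) * (2 * η * r) := by
    nlinarith [mul_nonneg hμ.le (sq_nonneg (a - b))]
  rw [mul_div_assoc', div_mul_eq_mul_div, le_div_iff₀ hμ]
  rcases (add_nonneg ha hb).eq_or_lt with h0 | h0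
  · rw [← h0, zero_mul]
    positivity
  · linarith [le_of_mul_le_mul_left key' h0]

/-- The saddle envelope is differentiable, with partial gradients `η (x - x₊)` and `η (y₊ - y)`. -/
theorem hasFDerivAt_saddleEnv (hL : ContDiff ℝ 2 L) (hweak : WeaklyConvexConcave ρ L)
    (hρ : ρ < η) (hη : 0 ≤ η) {prox : Eu n × Eu m → Eu n × Eu m}
    (hprox : ∀ z, IsProxPoint η L z (prox z)) (z : Eu n × Eu m) :
    HasFDerivAt (saddleEnv η L prox)
      ((innerSL ℝ (η • (z.1 - (prox z).1))).coprod (innerSL ℝ (η • ((prox z).2 - z.2)))) z := by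
  rw [hasFDerivAt_iff_isLittleO]
  refine Asymptotics.IsBigO.trans_isLittleO (g := fun z' => ‖z' - z‖ ^ 2) ?_
    (Asymptotics.isLittleO_pow_sub_sub z one_lt_two)
  refine Asymptotics.IsBigO.of_bound (η / 2 + η * (2 * (η / (η - ρ))))
    (Eventually.of_forall fun z' => ?_)
  have hlip := IsProxPoint.norm_sub_add_norm_sub_le hL hweak hρ hη (hprox z) (hprox z')
  have u1 := (hprox z').2 (prox z).1
  have u2 := (hprox z).1 (prox z').2
  have l1 := (hprox z).2 (prox z').1
  have l2 := (hprox z').1 (prox z).2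
  simp only [saddleEnv, ContinuousLinearMap.coprod_apply, innerSL_apply_apply, Prod.fst_sub,
    Prod.snd_sub, real_inner_smul_left]
  generalize prox z = w at *
  generalize prox z' = w' at *
  have e1 := norm_sub_sq_eq_add_sub_inner w.1 z'.1 z.1
  have e2 := norm_sub_sq_eq_add_sub_inner w'.1 z'.1 z.1
  have e3 := norm_sub_sq_eq_add_sub_inner w.2 z'.2 z.2
  have e4 := norm_sub_sq_eq_add_sub_inner w'.2 z'.2 z.2
  have i1 : ⟪w'.1 - w.1, z'.1 - z.1⟫ ≤ ‖w'.1 - w.1‖ * ‖z' - z‖ :=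
    (real_inner_le_norm _ _).trans
      (mul_le_mul_of_nonneg_left (norm_fst_le (z' - z)) (norm_nonneg _))
  have i2 : ⟪w'.2 - w.2, z'.2 - z.2⟫ ≤ ‖w'.2 - w.2‖ * ‖z' - z‖ :=
    (real_inner_le_norm _ _).trans
      (mul_le_mul_of_nonneg_left (norm_snd_le (z' - z)) (norm_nonneg _))
  rw [← sub_sub_sub_cancel_right w'.1 w.1 z.1, inner_sub_left, sub_sub_sub_cancel_right] at i1
  rw [← sub_sub_sub_cancel_right w'.2 w.2 z.2, inner_sub_left, sub_sub_sub_cancel_right] at i2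
  have n1 : ‖z'.1 - z.1‖ ^ 2 ≤ ‖z' - z‖ ^ 2 := by
    gcongr
    exact norm_fst_le (z' - z)
  have n2 : ‖z'.2 - z.2‖ ^ 2 ≤ ‖z' - z‖ ^ 2 := by
    gcongr
    exact norm_snd_le (z' - z)
  rw [← neg_sub w.1 z.1, inner_neg_left, norm_pow, norm_norm, Real.norm_eq_abs, abs_le]
  simp only [proxObj] at *
  have hr : 0 ≤ η * ‖z' - z‖ := by positivity
  have hlip' := mul_le_mul_of_nonneg_left hlip hr
  have a1 : 0 ≤ η * ‖z' - z‖ * ‖w'.1 - w.1‖ := by positivity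
  have a2 : 0 ≤ η * ‖z' - z‖ * ‖w'.2 - w.2‖ := by positivity
  have j1 := mul_le_mul_of_nonneg_left i1 hη
  have j2 := mul_le_mul_of_nonneg_left i2 hη
  have m1 := mul_le_mul_of_nonneg_left n1 hη
  have m2 := mul_le_mul_of_nonneg_left n2 hη
  have p1 : 0 ≤ η * ‖z'.1 - z.1‖ ^ 2 := by positivity
  have p2 : 0 ≤ η * ‖z'.2 - z.2‖ ^ 2 := by positivity
  rw [e1, e2, e4] at u1
  rw [e2, e3, e4] at l2
  rw [e2, e4]
  constructor <;> linarith

end SaddleEnvelope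

/-- gradient formula for the saddle envelope. -/
theorem statement3 {n m : ℕ}
    (L : Eu n × Eu m → ℝ) (ρ η : ℝ)
    (hL : ContDiff ℝ 2 L)
    (hweak : WeaklyConvexConcave ρ L)
    (hη : max ρ 0 < η)
    (prox : Eu n × Eu m → Eu n × Eu m)
    (hprox : ∀ z, IsProxPoint η L z (prox z))
    (hprox_uniq : ∀ z w, IsProxPoint η L z w → w = prox z) :
    ∀ z : Eu n × Eu m,
      DifferentiableAt ℝ (saddleEnv η L prox) z ∧
      gradx (saddleEnv η L prox) z = η • (z.1 - (prox z).1) ∧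
      η • (z.1 - (prox z).1) = gradx L (prox z) ∧
      grady (saddleEnv η L prox) z = η • ((prox z).2 - z.2) ∧
      η • ((prox z).2 - z.2) = grady L (prox z) := by
  intro z
  have hρ : ρ < η := (le_max_left ρ 0).trans_lt hη
  have hη' : 0 ≤ η := (le_max_right ρ 0).trans hη.le
  have h := hasFDerivAt_saddleEnv hL hweak hρ hη' hprox z
  refine ⟨h.differentiableAt, ?_, ((hprox z).gradx_eq hL).symm, ?_, ((hprox z).grady_eq hL).symm⟩
  · refine HasGradientAt.gradient (hasGradientAt_iff_hasFDerivAt.2 ?_)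
    refine (h.comp z.1 (hasFDerivAt_prodMk_left (𝕜 := ℝ) z.1 z.2)).congr_fderiv ?_
    ext v
    simp
  · refine HasGradientAt.gradient (hasGradientAt_iff_hasFDerivAt.2 ?_)
    refine (h.comp z.2 (hasFDerivAt_prodMk_right (𝕜 := ℝ) z.1 z.2)).congr_fderiv ?_
    ext v
    simp

end
end

section
/- Let L : ℝⁿ × ℝᵐ → ℝ be twice continuously differentiable and ρ-weakly convex–weakly concave, and let η > max(ρ, 0). For z ∈ ℝⁿ × ℝᵐ write z₊ = prox_η(z), and define the block matrices J_η(z) = [[∇²_{xx}L_η(z), ∇²_{xy}L_η(z)], [−∇²_{yx}L_η(z), −∇²_{yy}L_η(z)]] and J(z₊) = [[∇²_{xx}L(z₊), ∇²_{xy}L(z₊)], [−∇²_{yx}L(z₊), −∇²_{yy}L(z₊)]]. Then the saddle envelope L_η is twice differentiable at z, the matrix ηI + J(z₊) is invertible, and J_η(z) = ηI − η²(ηI + J(z₊))⁻¹. -/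
open Filter Topology Metric
open scoped RealInnerProductSpace

noncomputable section

theorem HasFDerivAt.gradient_fst {n m : ℕ} {L : Eu n × Eu m → ℝ} {L' : Eu n × Eu m →L[ℝ] ℝ}
    {x : Eu n} {y : Eu m} (h : HasFDerivAt L L' (x, y)) :
    gradient (fun u => L (u, y)) x =
      (InnerProductSpace.toDual ℝ (Eu n)).symm (L'.comp (.inl ℝ _ _)) :=
  congrArg _ (h.comp x (hasFDerivAt_prodMk_left x y)).fderiv

theorem HasFDerivAt.gradient_snd {n m : ℕ} {L : Eu n × Eu m → ℝ} {L' : Eu n × Eu m →L[ℝ] ℝ}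
    {x : Eu n} {y : Eu m} (h : HasFDerivAt L L' (x, y)) :
    gradient (fun v => L (x, v)) y =
      (InnerProductSpace.toDual ℝ (Eu m)).symm (L'.comp (.inr ℝ _ _)) :=
  congrArg _ (h.comp y (hasFDerivAt_prodMk_right x y)).fderiv

/-- The Riesz representative of the restriction of a functional to the first factor. -/
def rieszFst (n m : ℕ) : ((Eu n × Eu m) →L[ℝ] ℝ) →L[ℝ] Eu n :=
  LinearMap.toContinuousLinearMap
    { toFun := fun φ => (InnerProductSpace.toDual ℝ (Eu n)).symm (φ.comp (.inl ℝ _ _))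
      map_add' := fun φ ψ => by simp [ContinuousLinearMap.add_comp]
      map_smul' := fun c φ => by simp [ContinuousLinearMap.smul_comp] }

/-- The Riesz representative of the restriction of a functional to the second factor. -/
def rieszSnd (n m : ℕ) : ((Eu n × Eu m) →L[ℝ] ℝ) →L[ℝ] Eu m :=
  LinearMap.toContinuousLinearMap
    { toFun := fun φ => (InnerProductSpace.toDual ℝ (Eu m)).symm (φ.comp (.inr ℝ _ _))
      map_add' := fun φ ψ => by simp [ContinuousLinearMap.add_comp]
      map_smul' := fun c φ => by simp [ContinuousLinearMap.smul_comp] }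

theorem rieszFst_apply {n m : ℕ} (φ : (Eu n × Eu m) →L[ℝ] ℝ) :
    rieszFst n m φ = (InnerProductSpace.toDual ℝ (Eu n)).symm (φ.comp (.inl ℝ _ _)) := rfl

theorem rieszSnd_apply {n m : ℕ} (φ : (Eu n × Eu m) →L[ℝ] ℝ) :
    rieszSnd n m φ = (InnerProductSpace.toDual ℝ (Eu m)).symm (φ.comp (.inr ℝ _ _)) := rfl

theorem inner_rieszFst {n m : ℕ} (φ : (Eu n × Eu m) →L[ℝ] ℝ) (u : Eu n) :
    ⟪rieszFst n m φ, u⟫ = φ (u, 0) := by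
  simp [rieszFst_apply]

theorem inner_rieszSnd {n m : ℕ} (φ : (Eu n × Eu m) →L[ℝ] ℝ) (v : Eu m) :
    ⟪rieszSnd n m φ, v⟫ = φ (0, v) := by
  simp [rieszSnd_apply]

theorem gradx_eq_rieszFst {n m : ℕ} {L : Eu n × Eu m → ℝ} (hL : Differentiable ℝ L) :
    gradx L = fun w => rieszFst n m (fderiv ℝ L w) :=
  funext fun w => (hL w).hasFDerivAt.gradient_fst

theorem grady_eq_rieszSnd {n m : ℕ} {L : Eu n × Eu m → ℝ} (hL : Differentiable ℝ L) :
    grady L = fun w => rieszSnd n m (fderiv ℝ L w) :=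
  funext fun w => (hL w).hasFDerivAt.gradient_snd

theorem inner_Hxx {n m : ℕ} {L : Eu n × Eu m → ℝ} (hL : ContDiff ℝ 2 L) (w : Eu n × Eu m)
    (v u : Eu n) : ⟪Hxx L w v, u⟫ = fderiv ℝ (fderiv ℝ L) w (v, 0) (u, 0) := by
  have hd : Differentiable ℝ (fderiv ℝ L) :=
    (hL.fderiv_right (m := 1) (by norm_num)).differentiable (by norm_num)
  have h : HasFDerivAt (fun x => gradient (fun u => L (u, w.2)) x)
      ((rieszFst n m).comp ((fderiv ℝ (fderiv ℝ L) w).comp (.inl ℝ _ _))) w.1 := by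
    have := (rieszFst n m).hasFDerivAt.comp w.1
      ((hd w).hasFDerivAt.comp w.1 (hasFDerivAt_prodMk_left w.1 w.2))
    refine this.congr_of_eventuallyEq (.of_forall fun x => ?_)
    exact congrFun (gradx_eq_rieszFst (hL.differentiable (by norm_num))) (x, w.2)
  rw [Hxx, h.fderiv]
  simp [inner_rieszFst]

theorem inner_Hyy {n m : ℕ} {L : Eu n × Eu m → ℝ} (hL : ContDiff ℝ 2 L) (w : Eu n × Eu m)
    (v u : Eu m) : ⟪Hyy L w v, u⟫ = fderiv ℝ (fderiv ℝ L) w (0, v) (0, u) := by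
  have hd : Differentiable ℝ (fderiv ℝ L) :=
    (hL.fderiv_right (m := 1) (by norm_num)).differentiable (by norm_num)
  have h : HasFDerivAt (fun y => gradient (fun v => L (w.1, v)) y)
      ((rieszSnd n m).comp ((fderiv ℝ (fderiv ℝ L) w).comp (.inr ℝ _ _))) w.2 := by
    have := (rieszSnd n m).hasFDerivAt.comp w.2
      ((hd w).hasFDerivAt.comp w.2 (hasFDerivAt_prodMk_right w.1 w.2))
    refine this.congr_of_eventuallyEq (.of_forall fun y => ?_)
    exact congrFun (grady_eq_rieszSnd (hL.differentiable (by norm_num))) (w.1, y)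
  rw [Hyy, h.fderiv]
  simp [inner_rieszSnd]

/-- The saddle gradient field `(∇ₓL, -∇_yL)`. -/
def saddleGrad {n m : ℕ} (L : Eu n × Eu m → ℝ) (w : Eu n × Eu m) : Eu n × Eu m :=
  (gradx L w, -grady L w)

theorem hasFDerivAt_saddleGrad {n m : ℕ} {L : Eu n × Eu m → ℝ} (hL : ContDiff ℝ 2 L)
    (w : Eu n × Eu m) :
    HasFDerivAt (saddleGrad L)
      (((rieszFst n m).prod (-rieszSnd n m)).comp (fderiv ℝ (fderiv ℝ L) w)) w := by
  have hd : Differentiable ℝ (fderiv ℝ L) :=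
    (hL.fderiv_right (m := 1) (by norm_num)).differentiable (by norm_num)
  have h1 := hL.differentiable (by norm_num)
  have := ((rieszFst n m).prod (-rieszSnd n m)).hasFDerivAt.comp w (hd w).hasFDerivAt
  refine this.congr_of_eventuallyEq (.of_forall fun x => ?_)
  simp [saddleGrad, gradx_eq_rieszFst h1, grady_eq_rieszSnd h1]

/-- The Euclidean inner product on a product, as a functional of its first argument. -/
def prodInner {n m : ℕ} (d : Eu n × Eu m) : (Eu n × Eu m) →L[ℝ] ℝ :=
  (innerSL ℝ d.1).comp (.fst ℝ _ _) + (innerSL ℝ d.2).comp (.snd ℝ _ _)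

theorem prodInner_apply {n m : ℕ} (d x : Eu n × Eu m) :
    prodInner d x = ⟪x.1, d.1⟫ + ⟪x.2, d.2⟫ := by
  simp [prodInner, real_inner_comm]

theorem sq_norm_le_prodInner_self {n m : ℕ} (d : Eu n × Eu m) : ‖d‖ ^ 2 ≤ prodInner d d := by
  rw [prodInner_apply, real_inner_self_eq_norm_sq, real_inner_self_eq_norm_sq, Prod.norm_def]
  rcases max_choice ‖d.1‖ ‖d.2‖ with h | h <;> rw [h] <;>
    nlinarith [sq_nonneg ‖d.1‖, sq_nonneg ‖d.2‖]

theorem prodInner_le {n m : ℕ} (d x : Eu n × Eu m) : prodInner d x ≤ 2 * ‖x‖ * ‖d‖ := by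
  have h1 := (real_inner_le_norm x.1 d.1).trans
    (mul_le_mul (norm_fst_le x) (norm_fst_le d) (norm_nonneg _) (norm_nonneg _))
  have h2 := (real_inner_le_norm x.2 d.2).trans
    (mul_le_mul (norm_snd_le x) (norm_snd_le d) (norm_nonneg _) (norm_nonneg _))
  rw [prodInner_apply]
  linarith

theorem neg_mul_prodInner_le_fderiv_saddleGrad {n m : ℕ} {L : Eu n × Eu m → ℝ} {ρ : ℝ}
    (hL : ContDiff ℝ 2 L) (hweak : WeaklyConvexConcave ρ L) (w d : Eu n × Eu m) :
    -ρ * prodInner d d ≤ prodInner d (fderiv ℝ (saddleGrad L) w d) := by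
  have hsymm : IsSymmSndFDerivAt ℝ L w :=
    hL.contDiffAt.isSymmSndFDerivAt (by simp)
  have h1 := (hweak w).1 d.1
  have h2 := (hweak w).2 d.2
  rw [inner_Hxx hL] at h1
  rw [inner_Hyy hL] at h2
  have h3 := hsymm.eq (d.1, 0) (0, d.2)
  have hd : d = (d.1, 0) + (0, d.2) := by simp
  have h4 : fderiv ℝ (fderiv ℝ L) w d =
      fderiv ℝ (fderiv ℝ L) w (d.1, 0) + fderiv ℝ (fderiv ℝ L) w (0, d.2) := by
    rw [← map_add, ← hd]
  rw [(hasFDerivAt_saddleGrad hL w).fderiv, prodInner_apply, prodInner_apply]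
  simp only [ContinuousLinearMap.comp_apply, ContinuousLinearMap.prod_apply, neg_apply,
    inner_neg_left, inner_rieszFst, inner_rieszSnd, h4, add_apply, real_inner_self_eq_norm_sq]
  linarith

theorem isUnit_smul_one_add_fderiv_saddleGrad {n m : ℕ} {L : Eu n × Eu m → ℝ} {ρ η : ℝ}
    (hL : ContDiff ℝ 2 L) (hweak : WeaklyConvexConcave ρ L) (hη : ρ < η) (w : Eu n × Eu m) :
    IsUnit (η • (1 : (Eu n × Eu m) →L[ℝ] (Eu n × Eu m)) + fderiv ℝ (saddleGrad L) w) := by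
  set T := η • (1 : (Eu n × Eu m) →L[ℝ] (Eu n × Eu m)) + fderiv ℝ (saddleGrad L) w with hT
  have hinj : Function.Injective T := by
    refine (injective_iff_map_eq_zero T).2 fun d hd => ?_
    have h1 := neg_mul_prodInner_le_fderiv_saddleGrad hL hweak w d
    have h2 : prodInner d (T d) =
        η * prodInner d d + prodInner d (fderiv ℝ (saddleGrad L) w d) := by
      simp [hT]
    rw [hd, map_zero] at h2
    have h3 := sq_norm_le_prodInner_self d
    have h4 : (η - ρ) * prodInner d d ≤ 0 := by linarith
    have h5 : prodInner d d ≤ 0 := nonpos_of_mul_nonpos_right h4 (sub_pos.2 hη)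
    exact norm_eq_zero.1 (pow_eq_zero_iff two_ne_zero |>.1 (le_antisymm (h3.trans h5) (sq_nonneg _)))
  exact ContinuousLinearMap.isUnit_iff_bijective.2
    ⟨hinj, LinearMap.injective_iff_surjective (f := (T : (Eu n × Eu m) →ₗ[ℝ] _)).1 hinj⟩

theorem saddleGrad_strongly_monotone {n m : ℕ} {L : Eu n × Eu m → ℝ} {ρ : ℝ}
    (hL : ContDiff ℝ 2 L) (hweak : WeaklyConvexConcave ρ L) (a b : Eu n × Eu m) :
    -ρ * prodInner (a - b) (a - b) ≤
      prodInner (a - b) (saddleGrad L a - saddleGrad L b) := by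
  have hline : ∀ t : ℝ, HasDerivAt (fun t : ℝ => b + t • (a - b)) (a - b) t := fun t => by
    simpa using ((hasDerivAt_id t).smul_const (a - b)).const_add b
  have hg : ∀ t : ℝ, HasDerivAt (fun t : ℝ => prodInner (a - b) (saddleGrad L (b + t • (a - b))))
      (prodInner (a - b) (fderiv ℝ (saddleGrad L) (b + t • (a - b)) (a - b))) t := fun t =>
    (prodInner (a - b)).hasFDerivAt.comp_hasDerivAt t
      ((hasFDerivAt_saddleGrad hL _).differentiableAt.hasFDerivAt.comp_hasDerivAt t (hline t))
  have := mul_sub_le_image_sub_of_le_deriv (fun t => (hg t).differentiableAt)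
    (C := -ρ * prodInner (a - b) (a - b))
    (fun t => by
      rw [(hg t).deriv]
      exact neg_mul_prodInner_le_fderiv_saddleGrad hL hweak _ _) (zero_le_one' ℝ)
  simpa using this

theorem IsProxPoint.saddleGrad_eq {n m : ℕ} {L : Eu n × Eu m → ℝ} {η : ℝ} {z w : Eu n × Eu m}
    (hL : Differentiable ℝ L) (h : IsProxPoint η L z w) :
    saddleGrad L w = η • (z - w) := by
  have hx : HasFDerivAt (fun u => proxObj η L z (u, w.2))
      ((fderiv ℝ L w).comp (.inl ℝ _ _) + η • innerSL ℝ (w.1 - z.1)) w.1 := by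
    have h1 := HasFDerivAt.comp (f := fun u => (u, w.2)) w.1 (hL w).hasFDerivAt
      (hasFDerivAt_prodMk_left w.1 w.2)
    have h2 := (((hasFDerivAt_id w.1).sub_const z.1).norm_sq).const_mul (η / 2)
    refine ((h1.add h2).sub_const (η / 2 * ‖w.2 - z.2‖ ^ 2)).congr_fderiv ?_
    ext u
    simp
    ring
  have hy : HasFDerivAt (fun v => proxObj η L z (w.1, v))
      ((fderiv ℝ L w).comp (.inr ℝ _ _) - η • innerSL ℝ (w.2 - z.2)) w.2 := by
    have h1 := HasFDerivAt.comp (f := fun v => (w.1, v)) w.2 (hL w).hasFDerivAt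
      (hasFDerivAt_prodMk_right w.1 w.2)
    have h2 := (((hasFDerivAt_id w.2).sub_const z.2).norm_sq).const_mul (η / 2)
    refine ((h1.add_const (η / 2 * ‖w.1 - z.1‖ ^ 2)).sub h2).congr_fderiv ?_
    ext u
    simp
    ring
  have hx0 := IsLocalMin.hasFDerivAt_eq_zero (.of_forall h.2) hx
  have hy0 := IsLocalMax.hasFDerivAt_eq_zero (.of_forall h.1) hy
  simp only [saddleGrad, gradx_eq_rieszFst hL, grady_eq_rieszSnd hL]
  refine Prod.ext (ext_inner_right ℝ fun u => ?_) (ext_inner_right ℝ fun u => ?_)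
  · have := DFunLike.congr_fun hx0 u
    simp [inner_rieszFst, inner_smul_left, inner_sub_left] at this ⊢
    linarith
  · have := DFunLike.congr_fun hy0 u
    simp [inner_rieszSnd, inner_smul_left, inner_sub_left] at this ⊢
    linarith

theorem continuous_of_isProxPoint {n m : ℕ} {L : Eu n × Eu m → ℝ} {ρ η : ℝ}
    (hL : ContDiff ℝ 2 L) (hweak : WeaklyConvexConcave ρ L) (hη : ρ < η)
    {prox : Eu n × Eu m → Eu n × Eu m} (hprox : ∀ z, IsProxPoint η L z (prox z)) :
    Continuous prox := by
  have hd : Differentiable ℝ L := hL.differentiable (by norm_num)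
  have hpos : 0 < η - ρ := sub_pos.2 hη
  refine (LipschitzWith.of_dist_le' (K := 2 * |η| / (η - ρ)) fun a b => ?_).continuous
  rw [dist_eq_norm, dist_eq_norm, div_mul_eq_mul_div, le_div_iff₀ hpos]
  set d := prox a - prox b with hdd
  have h1 := saddleGrad_strongly_monotone hL hweak (prox a) (prox b)
  rw [(hprox a).saddleGrad_eq hd, (hprox b).saddleGrad_eq hd,
    show η • (a - prox a) - η • (b - prox b) = η • (a - b) - η • d by rw [hdd]; module,
    ← hdd, map_sub _ _ (η • d), map_smul _ η d, smul_eq_mul] at h1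
  have h2 := prodInner_le d (η • (a - b))
  rw [norm_smul, Real.norm_eq_abs] at h2
  have h3 := mul_le_mul_of_nonneg_left (sq_norm_le_prodInner_self d) hpos.le
  rcases (norm_nonneg d).eq_or_lt with h0 | h0
  · rw [← h0, zero_mul]
    positivity
  · refine le_of_mul_le_mul_right ?_ h0
    nlinarith

theorem hasFDerivAt_of_isProxPoint {n m : ℕ} {L : Eu n × Eu m → ℝ} {ρ η : ℝ}
    (hL : ContDiff ℝ 2 L) (hweak : WeaklyConvexConcave ρ L) (hη : ρ < η) (hη0 : η ≠ 0)
    {prox : Eu n × Eu m → Eu n × Eu m} (hprox : ∀ z, IsProxPoint η L z (prox z))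
    (z : Eu n × Eu m) :
    HasFDerivAt prox (η • Ring.inverse (η • (1 : (Eu n × Eu m) →L[ℝ] (Eu n × Eu m)) +
      fderiv ℝ (saddleGrad L) (prox z))) z := by
  have hd : Differentiable ℝ L := hL.differentiable (by norm_num)
  obtain ⟨T, hT⟩ := isUnit_smul_one_add_fderiv_saddleGrad hL hweak hη (prox z)
  have hG : HasFDerivAt (fun w => η • w + saddleGrad L w)
      (ContinuousLinearEquiv.unitsEquiv ℝ _ T : (Eu n × Eu m) →L[ℝ] (Eu n × Eu m)) (prox z) := by
    have := ((hasFDerivAt_id (prox z)).const_smul η).add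
      (hasFDerivAt_saddleGrad hL (prox z)).differentiableAt.hasFDerivAt
    exact this.congr_fderiv hT.symm
  have hinv : ∀ y, η • prox (η⁻¹ • y) + saddleGrad L (prox (η⁻¹ • y)) = y := fun y => by
    rw [(hprox _).saddleGrad_eq hd, ← smul_add, add_sub_cancel, smul_inv_smul₀ hη0]
  have hz : prox (η⁻¹ • (η • z)) = prox z := by rw [inv_smul_smul₀ hη0]
  have hcont : Continuous fun y => prox (η⁻¹ • y) :=
    (continuous_of_isProxPoint hL hweak hη hprox).comp (continuous_const_smul _)
  have h1 : HasFDerivAt (fun y => prox (η⁻¹ • y))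
      ((ContinuousLinearEquiv.unitsEquiv ℝ _ T).symm : (Eu n × Eu m) →L[ℝ] (Eu n × Eu m))
      (η • z) :=
    HasFDerivAt.of_local_left_inverse hcont.continuousAt (by rwa [hz]) (.of_forall hinv)
  have h2 := h1.comp z ((hasFDerivAt_id z).const_smul η)
  rw [← hT, Ring.inverse_unit]
  refine (h2.congr_of_eventuallyEq (.of_forall fun y => ?_)).congr_fderiv ?_
  · simp [inv_smul_smul₀ hη0]
  · refine ContinuousLinearMap.ext fun v => ?_
    exact map_smul (ContinuousLinearEquiv.unitsEquiv ℝ _ T).symm η v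

theorem saddleGrad_saddleEnv {n m : ℕ} {L : Eu n × Eu m → ℝ} {η : ℝ}
    (hL : Differentiable ℝ L) {prox : Eu n × Eu m → Eu n × Eu m}
    (hprox : ∀ z, IsProxPoint η L z (prox z)) (hd : Differentiable ℝ prox) (z : Eu n × Eu m) :
    saddleGrad (saddleEnv η L prox) z = η • (z - prox z) := by
  have hS := (hprox z).saddleGrad_eq hL
  simp only [saddleGrad, gradx_eq_rieszFst hL, grady_eq_rieszSnd hL] at hS
  have hz := (hd z).hasFDerivAt
  set D := fderiv ℝ prox z
  have hx := ((hasFDerivAt_fst.comp z hz).sub hasFDerivAt_fst).norm_sq.const_mul (η / 2)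
  have hy := ((hasFDerivAt_snd.comp z hz).sub hasFDerivAt_snd).norm_sq.const_mul (η / 2)
  have h : HasFDerivAt (saddleEnv η L prox)
      (η • (innerSL ℝ (z - prox z).1).comp (.fst ℝ _ _) -
        η • (innerSL ℝ (z - prox z).2).comp (.snd ℝ _ _)) z := by
    refine ((((hL (prox z)).hasFDerivAt.comp z hz).add hx).sub hy).congr_fderiv ?_
    refine ContinuousLinearMap.ext fun v => ?_
    have h1 := congrArg (fun p : Eu n × Eu m => ⟪p.1, (D v).1⟫) hS
    have h2 := congrArg (fun p : Eu n × Eu m => ⟪p.2, (D v).2⟫) hS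
    have h3 : fderiv ℝ L (prox z) (D v) =
        fderiv ℝ L (prox z) ((D v).1, 0) + fderiv ℝ L (prox z) (0, (D v).2) := by
      rw [← map_add]; simp
    simp [inner_rieszFst, inner_rieszSnd, inner_smul_left, inner_sub_left] at h1 h2
    simp [h3]
    linarith
  have hgx : gradx (saddleEnv η L prox) z = _ := HasFDerivAt.gradient_fst h
  have hgy : grady (saddleEnv η L prox) z = _ := HasFDerivAt.gradient_snd h
  rw [saddleGrad, hgx, hgy, ← rieszFst_apply, ← rieszSnd_apply]
  refine Prod.ext (ext_inner_right ℝ fun u => ?_) (ext_inner_right ℝ fun u => ?_)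
  · rw [inner_rieszFst]
    simp [inner_smul_left, inner_sub_left]
  · rw [inner_neg_left, inner_rieszSnd]
    simp [inner_smul_left, inner_sub_left]

/-- Hessian formula for the saddle envelope, expressed through the
"saddle Jacobian" z ↦ (∇ₓ·, −∇_y·) of the gradient field. -/
theorem statement6 {n m : ℕ}
    (L : Eu n × Eu m → ℝ) (ρ η : ℝ)
    (hL : ContDiff ℝ 2 L)
    (hweak : WeaklyConvexConcave ρ L)
    (hη : max ρ 0 < η)
    (prox : Eu n × Eu m → Eu n × Eu m)
    (hprox : ∀ z, IsProxPoint η L z (prox z))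
    (hprox_uniq : ∀ z w, IsProxPoint η L z w → w = prox z) :
    ∀ z : Eu n × Eu m,
      IsUnit (η • (1 : (Eu n × Eu m) →L[ℝ] (Eu n × Eu m)) +
        fderiv ℝ (fun w => ((gradx L w, -grady L w) : Eu n × Eu m)) (prox z)) ∧
      HasFDerivAt
        (fun w => ((gradx (saddleEnv η L prox) w, -grady (saddleEnv η L prox) w) :
          Eu n × Eu m))
        (η • (1 : (Eu n × Eu m) →L[ℝ] (Eu n × Eu m)) -
          η ^ 2 • Ring.inverse (η • (1 : (Eu n × Eu m) →L[ℝ] (Eu n × Eu m)) +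
            fderiv ℝ (fun w => ((gradx L w, -grady L w) : Eu n × Eu m)) (prox z))) z := by
  intro z
  have hρ : ρ < η := (le_max_left _ _).trans_lt hη
  have hη0 : η ≠ 0 := ((le_max_right _ _).trans_lt hη).ne'
  refine ⟨isUnit_smul_one_add_fderiv_saddleGrad hL hweak hρ (prox z), ?_⟩
  have hp := hasFDerivAt_of_isProxPoint hL hweak hρ hη0 hprox
  have hS := saddleGrad_saddleEnv (hL.differentiable (by norm_num)) hprox
    fun z => (hp z).differentiableAt
  refine ((((hasFDerivAt_id z).sub (hp z)).const_smul η).congr_of_eventuallyEq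
    (.of_forall hS)).congr_fderiv ?_
  rw [smul_sub, smul_smul, ← sq]
  rfl

end
end
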